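/- For all i ∈ ℤ₈ and j ∈ ℤ₇, r̄(σ e_i ⊗ (e_j∧(e⌟Φ) − e∧(e_j⌟Φ))) = e_i ⊗ β_j. Consequently, r̄ restricts to a linear isomorphism from the subspace W̄ := span{e_i ⊗ (e_j∧(e⌟Φ) − e∧(e_j⌟Φ)) : i ∈ ℤ₈, j ∈ ℤ₇} of (ℝ⁸)*⊗Λ⁴(ℝ⁸)* onto (ℝ⁸)*⊗span{β₀,…,β₆}. -/

import Mathlib

open scoped BigOperators RealInnerProductSpace

noncomputable section

abbrev Form (n p : ℕ) := (Fin p → EuclideanSpace ℝ (Fin n)) → ℝ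

namespace Form

/-- Wedge product of forms (shuffle convention; full antisymmetrization divided by p!q!). -/
def wedge {n p q : ℕ} (α : Form n p) (β : Form n q) : Form n (p + q) :=
  fun x =>
    (((p.factorial * q.factorial : ℕ) : ℝ))⁻¹ *
      ∑ σ : Equiv.Perm (Fin (p + q)),
        ((Equiv.Perm.sign σ : ℤ) : ℝ) *
          (α fun i => x (σ (Fin.castAdd q i))) * (β fun j => x (σ (Fin.natAdd p j)))

/-- Inner product of `p`-forms. -/
def inner' {n p : ℕ} (α β : Form n p) : ℝ :=
  ((p.factorial : ℕ) : ℝ)⁻¹ *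
    ∑ f : Fin p → Fin n,
      (α fun k => EuclideanSpace.single (f k) 1) * (β fun k => EuclideanSpace.single (f k) 1)

/-- Interior product of a vector and a form. -/
def iprod {n p : ℕ} (v : EuclideanSpace ℝ (Fin n)) (α : Form n (p + 1)) : Form n p :=
  fun x => α (Fin.cons v x)

end Form

infixl:72 " ⋏ " => Form.wedge

/-- The 1-form dual to a vector. -/
def dual {n : ℕ} (v : EuclideanSpace ℝ (Fin n)) : Form n 1 := fun x => ⟪v, x 0⟫

abbrev E8 := EuclideanSpace ℝ (Fin 8)

/-- The basis vector `e`. -/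
def e8 : E8 := EuclideanSpace.single 7 1

/-- The basis vectors `e₀,…,e₆` indexed mod 7. -/
def u7 (i : ZMod 7) : E8 := EuclideanSpace.single ⟨i.val, i.val_lt.trans (by norm_num)⟩ 1

/-- The basis indexed by ℤ₈, with `e₇ = e`. -/
def u8 (i : ZMod 8) : E8 := EuclideanSpace.single ⟨i.val, i.val_lt⟩ 1

/-- The Spin(7) fundamental 4-form. -/
def Phi (σ : ℝ) : Form 8 4 := fun x =>
  (∑ i : ZMod 7, (dual e8 ⋏ dual (u7 i) ⋏ dual (u7 (i + 1)) ⋏ dual (u7 (i + 3))) x)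
    - σ * ∑ i : ZMod 7,
        (dual (u7 (i + 2)) ⋏ dual (u7 (i + 4)) ⋏ dual (u7 (i + 5)) ⋏ dual (u7 (i + 6))) x

/-- The standard volume form of ℝ⁸. -/
def vol8 : Form 8 8 :=
  dual e8 ⋏ dual (u7 0) ⋏ dual (u7 1) ⋏ dual (u7 2) ⋏ dual (u7 3) ⋏ dual (u7 4) ⋏ dual (u7 5)
    ⋏ dual (u7 6)

/-- The 2-forms spanning spin(7)ᗮ. -/
def beta (σ : ℝ) (i : ZMod 7) : Form 8 2 := fun x =>
  σ * (dual (u7 i) ⋏ dual e8) x + (dual (u7 (i + 1)) ⋏ dual (u7 (i + 3))) x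
    + (dual (u7 (i + 4)) ⋏ dual (u7 (i + 5))) x + (dual (u7 (i + 2)) ⋏ dual (u7 (i + 6))) x

/-- The 4-form `y∧(z⌟Φ) − z∧(y⌟Φ)`. -/
def chi (σ : ℝ) (y z : E8) : Form 8 4 := fun w =>
  (dual y ⋏ (Form.iprod z (Phi σ) : Form 8 3)) w - (dual z ⋏ (Form.iprod y (Phi σ) : Form 8 3)) w

/-- The map `r̄` on 1-forms with values in 4-forms:
`r̄(T)(x,y,z) = (1/8)⟨x⌟T, y∧(z⌟Φ) − z∧(y⌟Φ)⟩`. -/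
def rbar (σ : ℝ) (T : E8 → Form 8 4) (x y z : E8) : ℝ :=
  (8 : ℝ)⁻¹ * Form.inner' (T x) (chi σ y z)

/-- The generator `e_i ⊗ (e_j∧(e⌟Φ) − e∧(e_j⌟Φ))` of `W̄`. -/
def TW (σ : ℝ) (i : ZMod 8) (j : ZMod 7) : E8 → Form 8 4 := fun x w =>
  ⟪u8 i, x⟫ * ((dual (u7 j) ⋏ (Form.iprod e8 (Phi σ) : Form 8 3)) w
    - (dual e8 ⋏ (Form.iprod (u7 j) (Phi σ) : Form 8 3)) w)

theorem sum_perm_two (g : Fin 2 → Fin 2 → ℝ) :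
    ∑ τ : Equiv.Perm (Fin 2), ((Equiv.Perm.sign τ : ℤ) : ℝ) * g (τ 0) (τ 1) = g 0 1 - g 1 0 := by
  simp [Finset.univ_perm_fin_succ, ← Finset.univ_product_univ,
    Fin.sum_univ_succ]
  ring

theorem sum_perm_three (g : Fin 3 → Fin 3 → Fin 3 → ℝ) :
    ∑ τ : Equiv.Perm (Fin 3), ((Equiv.Perm.sign τ : ℤ) : ℝ) * g (τ 0) (τ 1) (τ 2)
      = g 0 1 2 - g 0 2 1 - g 1 0 2 + g 1 2 0 + g 2 0 1 - g 2 1 0 := by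
  have e (σ : Equiv.Perm (Fin 2)) (p : Fin 3) :
      Equiv.Perm.decomposeFin.symm (p, σ) 2 = Equiv.swap 0 p (σ 1).succ :=
    Equiv.Perm.decomposeFin_symm_apply_succ σ p 1
  simp [Finset.univ_perm_fin_succ, ← Finset.univ_product_univ, Finset.sum_product,
    Fin.sum_univ_succ, Equiv.Perm.decomposeFin.symm_sign, Equiv.swap_apply_def, e]
  ring

theorem sum_perm_four (g : Fin 4 → Fin 4 → Fin 4 → Fin 4 → ℝ) :
    ∑ τ : Equiv.Perm (Fin 4), ((Equiv.Perm.sign τ : ℤ) : ℝ) * g (τ 0) (τ 1) (τ 2) (τ 3)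
      = g 0 1 2 3 - g 0 1 3 2 - g 0 2 1 3 + g 0 2 3 1 + g 0 3 1 2 - g 0 3 2 1
        - g 1 0 2 3 + g 1 0 3 2 + g 1 2 0 3 - g 1 2 3 0 - g 1 3 0 2 + g 1 3 2 0
        + g 2 0 1 3 - g 2 0 3 1 - g 2 1 0 3 + g 2 1 3 0 + g 2 3 0 1 - g 2 3 1 0
        - g 3 0 1 2 + g 3 0 2 1 + g 3 1 0 2 - g 3 1 2 0 - g 3 2 0 1 + g 3 2 1 0 := by
  have e2 (σ : Equiv.Perm (Fin 3)) (p : Fin 4) :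
      Equiv.Perm.decomposeFin.symm (p, σ) 2 = Equiv.swap 0 p (σ 1).succ :=
    Equiv.Perm.decomposeFin_symm_apply_succ σ p 1
  have e3 (σ : Equiv.Perm (Fin 3)) (p : Fin 4) :
      Equiv.Perm.decomposeFin.symm (p, σ) 3 = Equiv.swap 0 p (σ 2).succ :=
    Equiv.Perm.decomposeFin_symm_apply_succ σ p 2
  have e (σ : Equiv.Perm (Fin 2)) (p : Fin 3) :
      Equiv.Perm.decomposeFin.symm (p, σ) 2 = Equiv.swap 0 p (σ 1).succ :=
    Equiv.Perm.decomposeFin_symm_apply_succ σ p 1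
  simp [Finset.univ_perm_fin_succ, ← Finset.univ_product_univ, Finset.sum_product,
    Fin.sum_univ_succ, Equiv.Perm.decomposeFin.symm_sign, Equiv.swap_apply_def, e, e2, e3]
  ring

namespace Form

/-- The wedge product as a bilinear map. -/
def wedgeₗ (n p q : ℕ) : Form n p →ₗ[ℝ] Form n q →ₗ[ℝ] Form n (p + q) :=
  LinearMap.mk₂ ℝ wedge
    (fun α α' β => by
      funext x
      simp only [wedge, Pi.add_apply, mul_add, add_mul, Finset.sum_add_distrib])
    (fun c α β => by
      funext x
      simp only [wedge, Pi.smul_apply, smul_eq_mul, Finset.mul_sum]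
      exact Finset.sum_congr rfl fun τ _ => by ring)
    (fun α β β' => by
      funext x
      simp only [wedge, Pi.add_apply, mul_add, Finset.sum_add_distrib])
    (fun c α β => by
      funext x
      simp only [wedge, Pi.smul_apply, smul_eq_mul, Finset.mul_sum]
      exact Finset.sum_congr rfl fun τ _ => by ring)

/-- The interior product with a fixed vector as a linear map. -/
def iprodₗ {n p : ℕ} (v : EuclideanSpace ℝ (Fin n)) : Form n (p + 1) →ₗ[ℝ] Form n p where
  toFun := iprod v
  map_add' _ _ := rfl
  map_smul' _ _ := rfl

/-- The inner product of `p`-forms as a bilinear map. -/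
def innerₗ (n p : ℕ) : Form n p →ₗ[ℝ] Form n p →ₗ[ℝ] ℝ :=
  LinearMap.mk₂ ℝ inner'
    (fun α α' β => by
      simp only [inner', Pi.add_apply, mul_add, add_mul, Finset.sum_add_distrib])
    (fun c α β => by
      simp only [inner', Pi.smul_apply, smul_eq_mul, Finset.mul_sum]
      exact Finset.sum_congr rfl fun τ _ => by ring)
    (fun α β β' => by
      simp only [inner', Pi.add_apply, mul_add, Finset.sum_add_distrib])
    (fun c α β => by
      simp only [inner', Pi.smul_apply, smul_eq_mul, Finset.mul_sum]
      exact Finset.sum_congr rfl fun τ _ => by ring)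

theorem wedge_comp_perm {n p q : ℕ} (α : Form n p) (β : Form n q)
    (x : Fin (p + q) → EuclideanSpace ℝ (Fin n)) (τ : Equiv.Perm (Fin (p + q))) :
    wedge α β (x ∘ τ) = ((Equiv.Perm.sign τ : ℤ) : ℝ) * wedge α β x := by
  simp only [wedge, Finset.mul_sum]
  refine Fintype.sum_equiv (Equiv.mulLeft τ) _ _ fun ρ => ?_
  have h : ((Equiv.Perm.sign τ : ℤ) : ℝ) * ((Equiv.Perm.sign τ : ℤ) : ℝ) = 1 := by
    rcases Int.units_eq_one_or (Equiv.Perm.sign τ) with h | h <;> simp [h]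
  simp only [Equiv.coe_mulLeft, Equiv.Perm.sign_mul, Units.val_mul, Int.cast_mul,
    Equiv.Perm.mul_apply, Function.comp_apply]
  linear_combination (-(((p.factorial * q.factorial : ℕ) : ℝ))⁻¹ * ((Equiv.Perm.sign ρ : ℤ) : ℝ) *
    (α fun i => x (τ (ρ (Fin.castAdd q i)))) * (β fun j => x (τ (ρ (Fin.natAdd p j))))) * h

end Form

theorem dual_wedge_dual {n : ℕ} (a b : EuclideanSpace ℝ (Fin n))
    (x : Fin 2 → EuclideanSpace ℝ (Fin n)) :
    (dual a ⋏ dual b) x = ⟪a, x 0⟫ * ⟪b, x 1⟫ - ⟪a, x 1⟫ * ⟪b, x 0⟫ := by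
  have h := sum_perm_two fun i j => ⟪a, x i⟫ * ⟪b, x j⟫
  simp only [Form.wedge, dual, mul_assoc]
  refine Eq.trans ?_ h
  norm_num
  rfl

theorem dual_wedge_dual_wedge_dual {n : ℕ} (a b c : EuclideanSpace ℝ (Fin n))
    (x : Fin 3 → EuclideanSpace ℝ (Fin n)) :
    (dual a ⋏ dual b ⋏ dual c) x =
      ⟪a, x 0⟫ * (⟪b, x 1⟫ * ⟪c, x 2⟫ - ⟪b, x 2⟫ * ⟪c, x 1⟫)
      - ⟪a, x 1⟫ * (⟪b, x 0⟫ * ⟪c, x 2⟫ - ⟪b, x 2⟫ * ⟪c, x 0⟫)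
      + ⟪a, x 2⟫ * (⟪b, x 0⟫ * ⟪c, x 1⟫ - ⟪b, x 1⟫ * ⟪c, x 0⟫) := by
  have h := sum_perm_three fun i j k =>
    (⟪a, x i⟫ * ⟪b, x j⟫ - ⟪a, x j⟫ * ⟪b, x i⟫) * ⟪c, x k⟫
  rw [Form.wedge]
  simp only [dual_wedge_dual, mul_assoc]
  refine Eq.trans (congrArg _ h) ?_
  norm_num [Nat.factorial]
  ring

/-- The decomposable 4-form `a ∧ b ∧ c ∧ d`. -/
def dualWedge (a b c d : E8) : Form 8 4 := dual a ⋏ dual b ⋏ dual c ⋏ dual d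

theorem dualWedge_apply (a b c d : E8) (x : Fin 4 → E8) :
    dualWedge a b c d x = ∑ τ : Equiv.Perm (Fin 4), ((Equiv.Perm.sign τ : ℤ) : ℝ) *
      (⟪a, x (τ 0)⟫ * ⟪b, x (τ 1)⟫ * ⟪c, x (τ 2)⟫ * ⟪d, x (τ 3)⟫) := by
  have h := sum_perm_four fun i j k l =>
      (⟪a, x i⟫ * (⟪b, x j⟫ * ⟪c, x k⟫ - ⟪b, x k⟫ * ⟪c, x j⟫)
      - ⟪a, x j⟫ * (⟪b, x i⟫ * ⟪c, x k⟫ - ⟪b, x k⟫ * ⟪c, x i⟫)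
      + ⟪a, x k⟫ * (⟪b, x i⟫ * ⟪c, x j⟫ - ⟪b, x j⟫ * ⟪c, x i⟫)) * ⟪d, x l⟫
  rw [sum_perm_four fun i j k l => ⟪a, x i⟫ * ⟪b, x j⟫ * ⟪c, x k⟫ * ⟪d, x l⟫]
  rw [dualWedge, Form.wedge]
  simp only [dual_wedge_dual_wedge_dual, mul_assoc] at h ⊢
  refine Eq.trans (congrArg _ h) ?_
  norm_num [Nat.factorial]
  ring

/-- The derivation action of `y ∧ z` on the arguments of a function of four vectors. -/
def wedgeAct {V : Type*} [AddCommGroup V] [Module ℝ V] (y z : E8) (F : E8 → E8 → E8 → E8 → V)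
    (a b c d : E8) : V :=
  ⟪z, a⟫ • F y b c d + ⟪z, b⟫ • F a y c d + ⟪z, c⟫ • F a b y d + ⟪z, d⟫ • F a b c y
    - ⟪y, a⟫ • F z b c d - ⟪y, b⟫ • F a z c d - ⟪y, c⟫ • F a b z d - ⟪y, d⟫ • F a b c z

/-- The signed sum of `G` over the fourteen quadruples of basis vectors occurring in `Phi σ`. -/
def quadSum {V : Type*} [AddCommGroup V] [Module ℝ V] (σ : ℝ) (G : E8 → E8 → E8 → E8 → V) : V :=
  ∑ i : ZMod 7, G e8 (u7 i) (u7 (i + 1)) (u7 (i + 3))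
    - σ • ∑ i : ZMod 7, G (u7 (i + 2)) (u7 (i + 4)) (u7 (i + 5)) (u7 (i + 6))

section

variable {V V' : Type*} [AddCommGroup V] [Module ℝ V] [AddCommGroup V'] [Module ℝ V']

theorem map_quadSum (ℓ : V →ₗ[ℝ] V') (σ : ℝ) (G : E8 → E8 → E8 → E8 → V) :
    ℓ (quadSum σ G) = quadSum σ fun a b c d => ℓ (G a b c d) := by
  simp only [quadSum, map_sub, map_smul, map_sum]

theorem map_wedgeAct (ℓ : V →ₗ[ℝ] V') (y z : E8) (F : E8 → E8 → E8 → E8 → V) (a b c d : E8) :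
    ℓ (wedgeAct y z F a b c d) = wedgeAct y z (fun a b c d => ℓ (F a b c d)) a b c d := by
  simp only [wedgeAct, map_sub, map_smul, map_add]

theorem quadSum_sub (σ : ℝ) (G G' : E8 → E8 → E8 → E8 → V) :
    quadSum σ (fun a b c d => G a b c d - G' a b c d) = quadSum σ G - quadSum σ G' := by
  simp only [quadSum, Finset.sum_sub_distrib, smul_sub]
  abel

theorem quadSum_add (σ : ℝ) (G G' : E8 → E8 → E8 → E8 → V) :
    quadSum σ (fun a b c d => G a b c d + G' a b c d) = quadSum σ G + quadSum σ G' := by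
  simp only [quadSum, Finset.sum_add_distrib, smul_add]
  abel

end

theorem Phi_eq_quadSum (σ : ℝ) : Phi σ = quadSum σ dualWedge := by
  funext x
  simp only [quadSum, Pi.sub_apply, Pi.smul_apply, Finset.sum_apply, smul_eq_mul]
  rfl

theorem dual_wedge_three (y : E8) (β : Form 8 3) (w : Fin 4 → E8) :
    Form.wedgeₗ 8 1 3 (dual y) β w = (6 : ℝ)⁻¹ * ∑ τ : Equiv.Perm (Fin 4),
      ((Equiv.Perm.sign τ : ℤ) : ℝ) * (⟪y, w (τ 0)⟫ * β ![w (τ 1), w (τ 2), w (τ 3)]) := by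
  have hc : (((1).factorial * (3).factorial : ℕ) : ℝ)⁻¹ = (6 : ℝ)⁻¹ := by norm_num [Nat.factorial]
  rw [← hc]
  change (_ : ℝ) * ∑ τ : Equiv.Perm (Fin 4), (_ : ℝ) = (_ : ℝ)
  congr 1
  refine Finset.sum_congr rfl fun τ _ => ?_
  rw [mul_assoc]
  congr 3
  funext k
  fin_cases k <;> rfl

theorem iprod_dualWedge (z a b c d u v w : E8) :
    Form.iprodₗ z (dualWedge a b c d) ![u, v, w] =
      ⟪a, z⟫ * ((dual b ⋏ dual c ⋏ dual d) ![u, v, w] : ℝ)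
      - ⟪b, z⟫ * ((dual a ⋏ dual c ⋏ dual d) ![u, v, w] : ℝ)
      + ⟪c, z⟫ * ((dual a ⋏ dual b ⋏ dual d) ![u, v, w] : ℝ)
      - ⟪d, z⟫ * ((dual a ⋏ dual b ⋏ dual c) ![u, v, w] : ℝ) := by
  change dualWedge a b c d ![z, u, v, w] = _
  rw [dualWedge_apply, sum_perm_four fun i j k l =>
    ⟪a, (![z, u, v, w] : Fin 4 → E8) i⟫ * ⟪b, (![z, u, v, w] : Fin 4 → E8) j⟫ *
      ⟪c, (![z, u, v, w] : Fin 4 → E8) k⟫ * ⟪d, (![z, u, v, w] : Fin 4 → E8) l⟫]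
  simp only [dual_wedge_dual_wedge_dual, Matrix.cons_val]
  ring

theorem dual_wedge_iprod_dualWedge (y z a b c d : E8) :
    Form.wedgeₗ 8 1 3 (dual y) (Form.iprodₗ z (dualWedge a b c d)) =
      ⟪z, a⟫ • dualWedge y b c d + ⟪z, b⟫ • dualWedge a y c d
        + ⟪z, c⟫ • dualWedge a b y d + ⟪z, d⟫ • dualWedge a b c y := by
  funext w
  have hw (p q r s : E8) := (dualWedge_apply p q r s w).trans <|
    sum_perm_four fun i j k l => ⟪p, w i⟫ * ⟪q, w j⟫ * ⟪r, w k⟫ * ⟪s, w l⟫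
  rw [dual_wedge_three, sum_perm_four fun i j k l =>
    ⟪y, w i⟫ * Form.iprodₗ z (dualWedge a b c d) ![w j, w k, w l]]
  simp only [iprod_dualWedge, dual_wedge_dual_wedge_dual, Matrix.cons_val, Pi.add_apply,
    Pi.smul_apply, smul_eq_mul, hw, real_inner_comm z]
  ring

theorem chi_eq_quadSum (σ : ℝ) (y z : E8) : chi σ y z = quadSum σ (wedgeAct y z dualWedge) := by
  have h : chi σ y z = Form.wedgeₗ 8 1 3 (dual y) (Form.iprodₗ z (Phi σ))
      - Form.wedgeₗ 8 1 3 (dual z) (Form.iprodₗ y (Phi σ)) := rfl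
  simp only [h, Phi_eq_quadSum, map_quadSum, dual_wedge_iprod_dualWedge, ← quadSum_sub]
  congr 1
  funext a b c d
  simp only [wedgeAct]
  abel

theorem chi_comp_perm (σ : ℝ) (y z : E8) (x : Fin 4 → E8) (τ : Equiv.Perm (Fin 4)) :
    chi σ y z (x ∘ τ) = ((Equiv.Perm.sign τ : ℤ) : ℝ) * chi σ y z x := by
  change Form.wedge (dual y) (Form.iprodₗ z (Phi σ)) (x ∘ τ)
    - Form.wedge (dual z) (Form.iprodₗ y (Phi σ)) (x ∘ τ) = _
  rw [Form.wedge_comp_perm, Form.wedge_comp_perm, ← mul_sub]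
  rfl

/-- The standard basis vectors of `E8`. -/
def basisVec (n : Fin 8) : E8 := EuclideanSpace.single n 1

theorem inner_basisVec (m n : Fin 8) : ⟪basisVec m, basisVec n⟫ = if m = n then (1 : ℝ) else 0 := by
  simp [basisVec, EuclideanSpace.inner_single_left]

theorem inner'_dualWedge_basisVec (a : Fin 4 → Fin 8) (β : Form 8 4)
    (hβ : ∀ x (τ : Equiv.Perm (Fin 4)), β (x ∘ τ) = ((Equiv.Perm.sign τ : ℤ) : ℝ) * β x) :
    Form.inner' (dualWedge (basisVec (a 0)) (basisVec (a 1)) (basisVec (a 2)) (basisVec (a 3))) β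
      = β (basisVec ∘ a) := by
  have hδ (τ : Equiv.Perm (Fin 4)) (f : Fin 4 → Fin 8) :
      ⟪basisVec (a 0), basisVec (f (τ 0))⟫ * ⟪basisVec (a 1), basisVec (f (τ 1))⟫ *
        ⟪basisVec (a 2), basisVec (f (τ 2))⟫ * ⟪basisVec (a 3), basisVec (f (τ 3))⟫
        = if f = a ∘ τ.symm then (1 : ℝ) else 0 := by
    simp only [inner_basisVec, ← ite_and, mul_ite, mul_one, mul_zero]
    refine if_congr ?_ rfl rfl
    rw [Equiv.eq_comp_symm, funext_iff]
    simp only [Fin.forall_fin_succ, Function.comp_apply, IsEmpty.forall_iff, and_true]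
    exact ⟨fun h => ⟨h.2.2.2.symm, h.2.2.1.symm, h.2.1.symm, h.1.symm⟩,
      fun h => ⟨h.2.2.2.symm, h.2.2.1.symm, h.2.1.symm, h.1.symm⟩⟩
  have hsum (τ : Equiv.Perm (Fin 4)) :
      ∑ f : Fin 4 → Fin 8, ((Equiv.Perm.sign τ : ℤ) : ℝ) * (if f = a ∘ τ.symm then (1 : ℝ) else 0) *
        β (basisVec ∘ f) = β (basisVec ∘ a) := by
    have h : ((Equiv.Perm.sign τ : ℤ) : ℝ) * ((Equiv.Perm.sign τ : ℤ) : ℝ) = 1 := by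
      rcases Int.units_eq_one_or (Equiv.Perm.sign τ) with h | h <;> simp [h]
    simp only [mul_ite, mul_one, mul_zero, ite_mul, zero_mul, Finset.sum_ite_eq',
      Finset.mem_univ, if_true]
    rw [← Function.comp_assoc, hβ, Equiv.Perm.sign_symm, ← mul_assoc, h, one_mul]
  change _ * ∑ f : Fin 4 → Fin 8, dualWedge _ _ _ _ (basisVec ∘ f) * β (basisVec ∘ f) = _
  simp only [dualWedge_apply, Function.comp_apply, hδ, Finset.sum_mul]
  rw [Finset.sum_comm, Finset.sum_congr rfl fun τ _ => hsum τ]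
  simp [Fintype.card_perm, Nat.factorial]

theorem quadSum_eq {V : Type*} [AddCommGroup V] [Module ℝ V] (σ : ℝ)
    (G : E8 → E8 → E8 → E8 → V) :
    let H : Fin 8 → Fin 8 → Fin 8 → Fin 8 → V :=
      fun a b c d => G (basisVec a) (basisVec b) (basisVec c) (basisVec d)
    quadSum σ G =
      (H 7 0 1 3 + H 7 1 2 4 + H 7 2 3 5 + H 7 3 4 6 + H 7 4 5 0 + H 7 5 6 1 + H 7 6 0 2)
      - σ • (H 2 4 5 6 + H 3 5 6 0 + H 4 6 0 1 + H 5 0 1 2 + H 6 1 2 3 + H 0 2 3 4 + H 1 3 4 5) := by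
  intro H
  exact congrArg₂ _ (Fin.sum_univ_seven _) (congrArg _ (Fin.sum_univ_seven _))

/-- `t + r` if `m = n`, and `r` otherwise. -/
def addIf (m n : ℕ) (t r : ℤ) : ℤ := bif m.beq n then t + r else r

/-- The `2 × 2` generalized Kronecker delta. -/
def kron2 (a b x y : ℕ) : ℤ :=
  addIf a x (addIf b y 1 0) (addIf a y (addIf b x (-1) 0) 0)

/-- The `3 × 3` generalized Kronecker delta. -/
def kron3 (a b c x y z : ℕ) : ℤ :=
  addIf a x (kron2 b c y z) (addIf a y (kron2 b c z x) (addIf a z (kron2 b c x y) 0))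

/-- The `4 × 4` generalized Kronecker delta. -/
def kron4 (a b c d x y z w : ℕ) : ℤ :=
  addIf a x (kron3 b c d y z w) (addIf a y (kron3 b c d x w z)
    (addIf a z (kron3 b c d x y w) (addIf a w (kron3 b c d x z y) 0)))

/-- Integral version of `wedgeAct`, with an accumulator `r`. -/
def wedgeActInt (y z : ℕ) (F : ℕ → ℕ → ℕ → ℕ → ℤ) (a b c d : ℕ) (r : ℤ) : ℤ :=
  addIf z a (F y b c d) (addIf z b (F a y c d) (addIf z c (F a b y d) (addIf z d (F a b c y)
    (addIf y a (-F z b c d) (addIf y b (-F a z c d) (addIf y c (-F a b z d)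
      (addIf y d (-F a b c z) r)))))))

/-- Integral version of `quadSum s (wedgeAct y z F)`. -/
def quadSumActInt (s : ℤ) (y z : ℕ) (F : ℕ → ℕ → ℕ → ℕ → ℤ) : ℤ :=
  let G := wedgeActInt y z F
  (G 7 0 1 3 <| G 7 1 2 4 <| G 7 2 3 5 <| G 7 3 4 6 <| G 7 4 5 0 <| G 7 5 6 1 <| G 7 6 0 2 0)
    - s * (G 2 4 5 6 <| G 3 5 6 0 <| G 4 6 0 1 <| G 5 0 1 2 <| G 6 1 2 3 <| G 0 2 3 4 <|
      G 1 3 4 5 0)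

/-- Integral version of `beta`. -/
def betaInt (s : ℤ) (i y z : ℕ) : ℤ :=
  s * kron2 i 7 y z + kron2 ((i + 1) % 7) ((i + 3) % 7) y z
    + kron2 ((i + 4) % 7) ((i + 5) % 7) y z + kron2 ((i + 2) % 7) ((i + 6) % 7) y z

theorem cast_addIf (m n : Fin 8) (t r : ℤ) :
    ((addIf m n t r : ℤ) : ℝ) = ⟪basisVec m, basisVec n⟫ * t + r := by
  rw [inner_basisVec, addIf]
  by_cases h : m = n
  · simp [h]
  · have h' : Nat.beq (m : ℕ) n = false := by
      rw [← Bool.not_eq_true, Nat.beq_eq]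
      exact fun hmn => h (Fin.ext hmn)
    simp [h, h']

theorem cast_kron2 (a b x y : Fin 8) : ((kron2 a b x y : ℤ) : ℝ) =
    ⟪basisVec a, basisVec x⟫ * ⟪basisVec b, basisVec y⟫
      - ⟪basisVec a, basisVec y⟫ * ⟪basisVec b, basisVec x⟫ := by
  simp only [kron2, cast_addIf]
  push_cast
  ring

theorem cast_kron4 (a b c d x y z w : Fin 8) : ((kron4 a b c d x y z w : ℤ) : ℝ) =
    dualWedge (basisVec a) (basisVec b) (basisVec c) (basisVec d)
      ![basisVec x, basisVec y, basisVec z, basisVec w] := by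
  have h := sum_perm_four fun i j k l =>
    ⟪basisVec a, ![basisVec x, basisVec y, basisVec z, basisVec w] i⟫ *
      ⟪basisVec b, ![basisVec x, basisVec y, basisVec z, basisVec w] j⟫ *
      ⟪basisVec c, ![basisVec x, basisVec y, basisVec z, basisVec w] k⟫ *
      ⟪basisVec d, ![basisVec x, basisVec y, basisVec z, basisVec w] l⟫
  rw [dualWedge_apply, h]
  simp only [kron4, kron3, cast_addIf, cast_kron2, Matrix.cons_val]
  push_cast
  ring

theorem cast_wedgeActInt (y z : Fin 8) (F : E8 → E8 → E8 → E8 → ℝ) (F' : ℕ → ℕ → ℕ → ℕ → ℤ)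
    (hF : ∀ a b c d : Fin 8,
      (F' a b c d : ℝ) = F (basisVec a) (basisVec b) (basisVec c) (basisVec d))
    (a b c d : Fin 8) (r : ℤ) :
    ((wedgeActInt y z F' a b c d r : ℤ) : ℝ) = wedgeAct (basisVec y) (basisVec z) F
      (basisVec a) (basisVec b) (basisVec c) (basisVec d) + r := by
  simp only [wedgeActInt, wedgeAct, cast_addIf, Int.cast_neg, hF, smul_eq_mul]
  ring

theorem cast_quadSumActInt (s : ℤ) (y z : Fin 8) (F : E8 → E8 → E8 → E8 → ℝ)
    (F' : ℕ → ℕ → ℕ → ℕ → ℤ)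
    (hF : ∀ a b c d : Fin 8,
      (F' a b c d : ℝ) = F (basisVec a) (basisVec b) (basisVec c) (basisVec d)) :
    ((quadSumActInt s y z F' : ℤ) : ℝ)
      = quadSum (s : ℝ) (wedgeAct (basisVec y) (basisVec z) F) := by
  have h (a b c d : Fin 8) (r : ℤ) := cast_wedgeActInt y z F F' hF a b c d r
  rw [quadSum_eq]
  change ((((wedgeActInt y z F' (7 : Fin 8) (0 : Fin 8) (1 : Fin 8) (3 : Fin 8) _) : ℤ) - s *
    (wedgeActInt y z F' (2 : Fin 8) (4 : Fin 8) (5 : Fin 8) (6 : Fin 8) _ : ℤ) : ℤ) : ℝ) = _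
  rw [Int.cast_sub, Int.cast_mul]
  congr 2
  · simp only [add_assoc]
    refine (h 7 0 1 3 _).trans (congrArg _ ?_)
    refine (h 7 1 2 4 _).trans (congrArg _ ?_)
    refine (h 7 2 3 5 _).trans (congrArg _ ?_)
    refine (h 7 3 4 6 _).trans (congrArg _ ?_)
    refine (h 7 4 5 0 _).trans (congrArg _ ?_)
    refine (h 7 5 6 1 _).trans (congrArg _ ?_)
    exact (h 7 6 0 2 0).trans (by simp)
  · simp only [add_assoc]
    refine (h 2 4 5 6 _).trans (congrArg _ ?_)
    refine (h 3 5 6 0 _).trans (congrArg _ ?_)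
    refine (h 4 6 0 1 _).trans (congrArg _ ?_)
    refine (h 5 0 1 2 _).trans (congrArg _ ?_)
    refine (h 6 1 2 3 _).trans (congrArg _ ?_)
    refine (h 0 2 3 4 _).trans (congrArg _ ?_)
    exact (h 1 3 4 5 0).trans (by simp)

theorem cast_chi (s : ℤ) (y z a b c d : Fin 8) :
    ((quadSumActInt s y z fun p q r t => kron4 p q r t a b c d : ℤ) : ℝ) =
      chi s (basisVec y) (basisVec z) (basisVec ∘ ![a, b, c, d]) := by
  have hx : basisVec ∘ ![a, b, c, d] = ![basisVec a, basisVec b, basisVec c, basisVec d] := by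
    funext k
    fin_cases k <;> rfl
  rw [cast_quadSumActInt s y z (fun p q r t => dualWedge p q r t (basisVec ∘ ![a, b, c, d])) _
    fun p q r t => by rw [hx]; exact cast_kron4 p q r t a b c d, chi_eq_quadSum]
  have h := map_quadSum (LinearMap.proj (R := ℝ) (φ := fun _ : Fin 4 → E8 => ℝ)
    (basisVec ∘ ![a, b, c, d])) s (wedgeAct (basisVec y) (basisVec z) dualWedge)
  simp only [map_wedgeAct] at h
  exact h.symm

theorem cast_inner'_chi (s : ℤ) (y z y' z' : Fin 8) :
    ((quadSumActInt s y z fun a b c d =>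
      quadSumActInt s y' z' fun p q r t => kron4 p q r t a b c d : ℤ) : ℝ) =
      Form.inner' (chi s (basisVec y) (basisVec z)) (chi s (basisVec y') (basisVec z')) := by
  have h := map_quadSum ((Form.innerₗ 8 4).flip (chi s (basisVec y') (basisVec z'))) s
    (wedgeAct (basisVec y) (basisVec z) dualWedge)
  simp only [map_wedgeAct, ← chi_eq_quadSum] at h
  refine Eq.trans ?_ h.symm
  refine cast_quadSumActInt s y z _ _ fun a b c d => ?_
  exact (cast_chi s y' z' a b c d).trans
    (inner'_dualWedge_basisVec ![a, b, c, d] _ (chi_comp_perm _ _ _)).symm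

set_option maxHeartbeats 4000000 in
theorem quadSumActInt_eq_betaInt (s : ℤ) (hs : s = 1 ∨ s = -1) :
    ∀ j ∈ [0, 1, 2, 3, 4, 5, 6], ∀ y ∈ [0, 1, 2, 3, 4, 5, 6, 7], ∀ z ∈ [0, 1, 2, 3, 4, 5, 6, 7],
      y < z → s * quadSumActInt s j 7 (fun a b c d =>
        quadSumActInt s y z fun p q r t => kron4 p q r t a b c d) = 8 * betaInt s j y z := by
  obtain rfl | rfl := hs <;> decide +kernel

theorem chi_swap (σ : ℝ) (y z : E8) : chi σ z y = -chi σ y z :=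
  funext fun _ => (neg_sub _ _).symm

theorem dual_add {n : ℕ} (a b : EuclideanSpace ℝ (Fin n)) : dual (a + b) = dual a + dual b :=
  funext fun _ => inner_add_left _ _ _

theorem dual_smul {n : ℕ} (r : ℝ) (a : EuclideanSpace ℝ (Fin n)) : dual (r • a) = r • dual a :=
  funext fun _ => real_inner_smul_left _ _ _

theorem dualWedge_eq_wedgeₗ (a b c d : E8) :
    dualWedge a b c d = Form.wedgeₗ 8 3 1
      (Form.wedgeₗ 8 2 1 (Form.wedgeₗ 8 1 1 (dual a) (dual b)) (dual c)) (dual d) := rfl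

theorem chi_add_left (σ : ℝ) (y y' z : E8) : chi σ (y + y') z = chi σ y z + chi σ y' z := by
  simp only [chi_eq_quadSum, ← quadSum_add]
  congr 1
  funext a b c d
  simp only [wedgeAct, dualWedge_eq_wedgeₗ, dual_add, map_add, LinearMap.add_apply,
    inner_add_left]
  module

theorem chi_smul_left (σ c : ℝ) (y z : E8) : chi σ (c • y) z = c • chi σ y z := by
  have h := map_quadSum (LinearMap.lsmul ℝ (Form 8 4) c) σ (wedgeAct y z dualWedge)
  rw [LinearMap.lsmul_apply] at h
  rw [chi_eq_quadSum, chi_eq_quadSum, h]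
  congr 1
  funext a b c d
  simp only [LinearMap.lsmul_apply, wedgeAct, dualWedge_eq_wedgeₗ, dual_smul, map_smul,
    LinearMap.smul_apply, real_inner_smul_left]
  module

/-- `chi σ` as a bilinear map. -/
def chiₗ (σ : ℝ) : E8 →ₗ[ℝ] E8 →ₗ[ℝ] Form 8 4 :=
  LinearMap.mk₂ ℝ (chi σ) (chi_add_left σ) (chi_smul_left σ)
    (fun y z z' => by
      rw [chi_swap σ _ y, chi_add_left, neg_add, ← chi_swap, ← chi_swap])
    (fun c y z => by rw [chi_swap σ _ y, chi_smul_left, ← smul_neg, ← chi_swap])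

theorem beta_apply (σ : ℝ) (j : ZMod 7) (y z : E8) : beta σ j ![y, z] =
    σ * (⟪u7 j, y⟫ * ⟪e8, z⟫ - ⟪u7 j, z⟫ * ⟪e8, y⟫)
      + (⟪u7 (j + 1), y⟫ * ⟪u7 (j + 3), z⟫ - ⟪u7 (j + 1), z⟫ * ⟪u7 (j + 3), y⟫)
      + (⟪u7 (j + 4), y⟫ * ⟪u7 (j + 5), z⟫ - ⟪u7 (j + 4), z⟫ * ⟪u7 (j + 5), y⟫)
      + (⟪u7 (j + 2), y⟫ * ⟪u7 (j + 6), z⟫ - ⟪u7 (j + 2), z⟫ * ⟪u7 (j + 6), y⟫) := by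
  simp only [beta, dual_wedge_dual, Matrix.cons_val]

theorem beta_swap (σ : ℝ) (j : ZMod 7) (y z : E8) : beta σ j ![z, y] = -beta σ j ![y, z] := by
  simp only [beta_apply]
  ring

/-- `beta σ j` as a bilinear map. -/
def betaₗ (σ : ℝ) (j : ZMod 7) : E8 →ₗ[ℝ] E8 →ₗ[ℝ] ℝ :=
  LinearMap.mk₂ ℝ (fun y z => beta σ j ![y, z])
    (fun y y' z => by simp only [beta_apply, inner_add_right]; ring)
    (fun c y z => by simp only [beta_apply, inner_smul_right, smul_eq_mul]; ring)
    (fun y z z' => by simp only [beta_apply, inner_add_right]; ring)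
    (fun c y z => by simp only [beta_apply, inner_smul_right, smul_eq_mul]; ring)

theorem cast_betaInt (s : ℤ) (j : ZMod 7) (y z : Fin 8) :
    ((betaInt s j.val y z : ℤ) : ℝ) = beta s j ![basisVec y, basisVec z] := by
  have h (k : ZMod 7) : ∃ m : Fin 8, (m : ℕ) = (j.val + k.val) % 7 ∧ u7 (j + k) = basisVec m :=
    ⟨⟨(j + k).val, (j + k).val_lt.trans (by norm_num)⟩, ZMod.val_add j k, rfl⟩
  obtain ⟨m₁, h₁, e₁⟩ := h 1
  obtain ⟨m₂, h₂, e₂⟩ := h 2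
  obtain ⟨m₃, h₃, e₃⟩ := h 3
  obtain ⟨m₄, h₄, e₄⟩ := h 4
  obtain ⟨m₅, h₅, e₅⟩ := h 5
  obtain ⟨m₆, h₆, e₆⟩ := h 6
  have h₀ := cast_kron2 ⟨j.val, j.val_lt.trans (by norm_num)⟩ 7 y z
  rw [beta_apply, e₁, e₂, e₃, e₄, e₅, e₆]
  have hv : betaInt s j.val y z = s * kron2 j.val 7 y z + kron2 m₁ m₃ y z
      + kron2 m₄ m₅ y z + kron2 m₂ m₆ y z := by
    rw [h₁, h₂, h₃, h₄, h₅, h₆]; rfl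
  rw [hv]
  push_cast
  rw [cast_kron2, cast_kron2, cast_kron2]
  change _ = _ * (⟪basisVec ⟨j.val, _⟩, _⟫ * ⟪basisVec 7, _⟫
    - ⟪basisVec ⟨j.val, _⟩, _⟫ * ⟪basisVec 7, _⟫) + _ + _ + _
  rw [← h₀]
  rfl

theorem inner'_chi_eq_beta (σ : ℝ) (hσ : σ = 1 ∨ σ = -1) (j : ZMod 7) (y z : E8) :
    σ * Form.inner' (chi σ (u7 j) e8) (chi σ y z) = 8 * beta σ j ![y, z] := by
  obtain ⟨s, hs, rfl⟩ : ∃ s : ℤ, (s = 1 ∨ s = -1) ∧ (s : ℝ) = σ := by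
    rcases hσ with rfl | rfl
    · exact ⟨1, by simp⟩
    · exact ⟨-1, by simp⟩
  suffices h : ((s : ℝ) • (chiₗ s).compr₂ (Form.innerₗ 8 4 (chi s (u7 j) e8)))
      = (8 : ℝ) • betaₗ s j from LinearMap.congr_fun₂ h y z
  let b := (EuclideanSpace.basisFun (Fin 8) ℝ).toBasis
  have hb (m : Fin 8) : b m = basisVec m := by simp [b, basisVec]
  have hlt (m n : Fin 8) (hmn : m < n) :
      s * Form.inner' (chi s (u7 j) e8) (chi s (basisVec m) (basisVec n))
        = 8 * beta s j ![basisVec m, basisVec n] := by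
    have hj : (j.val : ℕ) ∈ [0, 1, 2, 3, 4, 5, 6] := by
      have := j.val_lt
      simp only [List.mem_cons, List.not_mem_nil]
      omega
    have h8 (k : Fin 8) : (k : ℕ) ∈ [0, 1, 2, 3, 4, 5, 6, 7] := by
      simp only [List.mem_cons, List.not_mem_nil]
      omega
    have h := congrArg (Int.cast (R := ℝ))
      (quadSumActInt_eq_betaInt s hs j.val hj m (h8 m) n (h8 n) hmn)
    rw [Int.cast_mul, Int.cast_mul, cast_betaInt] at h
    refine Eq.trans (congrArg _ ?_) h
    exact (cast_inner'_chi s ⟨j.val, j.val_lt.trans (by norm_num)⟩ 7 m n).symm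
  refine b.ext fun m => b.ext fun n => ?_
  rw [hb, hb]
  change s * Form.inner' (chi s (u7 j) e8) (chi s (basisVec m) (basisVec n))
        = 8 * beta s j ![basisVec m, basisVec n]
  have hswap (y z : E8) : Form.inner' (chi s (u7 j) e8) (chi s z y) =
      -Form.inner' (chi s (u7 j) e8) (chi s y z) := by
    rw [chi_swap s y z]
    exact map_neg (Form.innerₗ 8 4 (chi s (u7 j) e8)) _
  rcases lt_trichotomy m n with h | rfl | h
  · exact hlt m n h
  · have h₁ := hswap (basisVec m) (basisVec m)
    have h₂ := beta_swap s j (basisVec m) (basisVec m)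
    rw [self_eq_neg] at h₁ h₂
    rw [h₁, h₂, mul_zero, mul_zero]
  · rw [hswap, beta_swap]
    linear_combination -hlt n m h

theorem rbar_smul_TW (σ : ℝ) (hσ : σ = 1 ∨ σ = -1) (i : ZMod 8) (j : ZMod 7) (x y z : E8) :
    rbar σ (σ • TW σ i j) x y z = ⟪u8 i, x⟫ * beta σ j ![y, z] := by
  have h : (σ • TW σ i j) x = (σ * ⟪u8 i, x⟫) • chi σ (u7 j) e8 := by
    rw [mul_smul]; rfl
  have h' := congrArg (fun ℓ => ℓ (chi σ y z))
    (map_smul (Form.innerₗ 8 4) (σ * ⟪u8 i, x⟫) (chi σ (u7 j) e8))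
  have h'' : Form.inner' ((σ * ⟪u8 i, x⟫) • chi σ (u7 j) e8) (chi σ y z)
    = (σ * ⟪u8 i, x⟫) * Form.inner' (chi σ (u7 j) e8) (chi σ y z) := h'
  rw [rbar, h, h'']
  linear_combination (8 : ℝ)⁻¹ * ⟪u8 i, x⟫ * inner'_chi_eq_beta σ hσ j y z

/-- `rbar σ` as a linear map. -/
def rbarₗ (σ : ℝ) : (E8 → Form 8 4) →ₗ[ℝ] (E8 → E8 → E8 → ℝ) where
  toFun := rbar σ
  map_add' T T' := by
    funext x y z
    have h := LinearMap.congr_fun (map_add (Form.innerₗ 8 4) (T x) (T' x)) (chi σ y z)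
    exact (congrArg _ h).trans (mul_add _ _ _)
  map_smul' c T := by
    funext x y z
    have h := LinearMap.congr_fun (map_smul (Form.innerₗ 8 4) c (T x)) (chi σ y z)
    exact (congrArg _ h).trans (mul_left_comm _ _ _)

theorem inner_u7 (i k : ZMod 7) : ⟪u7 i, u7 k⟫ = if i = k then (1 : ℝ) else 0 :=
  (inner_basisVec _ _).trans <|
    if_congr (by rw [Fin.mk.injEq, (ZMod.val_injective 7).eq_iff]) rfl rfl

theorem inner_u8 (i k : ZMod 8) : ⟪u8 i, u8 k⟫ = if i = k then (1 : ℝ) else 0 :=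
  (inner_basisVec _ _).trans <|
    if_congr (by rw [Fin.mk.injEq, (ZMod.val_injective 8).eq_iff]) rfl rfl

theorem inner_u7_e8 (i : ZMod 7) : ⟪u7 i, e8⟫ = (0 : ℝ) :=
  (inner_basisVec _ 7).trans <| if_neg fun h => i.val_lt.ne (congrArg Fin.val h)

theorem beta_u7_e8 (σ : ℝ) (j k : ZMod 7) :
    beta σ j ![u7 k, e8] = if j = k then σ else 0 := by
  have h : ‖e8‖ = 1 := by simp [e8]
  simp [beta_apply, inner_u7, inner_u7_e8, h]

theorem bijOn_rbar (σ : ℝ) (hσ : σ = 1 ∨ σ = -1) :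
    Set.BijOn (rbar σ)
      (Submodule.span ℝ (Set.range fun p : ZMod 8 × ZMod 7 => TW σ p.1 p.2) : Set (E8 → Form 8 4))
      (Submodule.span ℝ (Set.range fun p : ZMod 8 × ZMod 7 =>
        fun x y z : E8 => ⟪u8 p.1, x⟫ * beta σ p.2 ![y, z]) : Set (E8 → E8 → E8 → ℝ)) := by
  have hσσ : σ * σ = 1 := by rcases hσ with rfl | rfl <;> norm_num
  have hTW (p : ZMod 8 × ZMod 7) : rbarₗ σ (TW σ p.1 p.2) =
      σ • fun x y z : E8 => ⟪u8 p.1, x⟫ * beta σ p.2 ![y, z] := by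
    have h : rbarₗ σ (σ • TW σ p.1 p.2) = fun x y z : E8 => ⟪u8 p.1, x⟫ * beta σ p.2 ![y, z] := by
      funext x y z
      exact rbar_smul_TW σ hσ p.1 p.2 x y z
    rw [← h, map_smul, smul_smul, hσσ, one_smul]
  refine ⟨?_, ?_, ?_⟩
  · change _ ≤ (Submodule.span ℝ _).comap (rbarₗ σ)
    rw [Submodule.span_le]
    rintro _ ⟨p, rfl⟩
    rw [SetLike.mem_coe, Submodule.mem_comap, hTW]
    exact Submodule.smul_mem _ _ (Submodule.subset_span ⟨p, rfl⟩)
  · intro T hT T' hT' hTT'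
    obtain ⟨c, rfl⟩ := Submodule.mem_span_range_iff_exists_fun ℝ |>.1 hT
    obtain ⟨c', rfl⟩ := Submodule.mem_span_range_iff_exists_fun ℝ |>.1 hT'
    have hc (c : ZMod 8 × ZMod 7 → ℝ) (p : ZMod 8 × ZMod 7) :
        rbarₗ σ (∑ p, c p • TW σ p.1 p.2) (u8 p.1) (u7 p.2) e8 = c p := by
      simp only [map_sum, map_smul, hTW, Finset.sum_apply, Pi.smul_apply, inner_u8, beta_u7_e8,
        smul_eq_mul]
      rw [Finset.sum_eq_single p]
      · simp [hσσ]
      · intro q _ hq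
        by_cases h₁ : q.1 = p.1
        · simp [show q.2 ≠ p.2 from fun h₂ => hq (Prod.ext h₁ h₂)]
        · simp [h₁]
      · simp
    have h : c = c' := funext fun p => by
      rw [← hc c p, ← hc c' p]
      exact congrFun₃ hTT' _ _ _
    rw [h]
  · change _ ≤ (Submodule.span ℝ _).map (rbarₗ σ)
    rw [Submodule.span_le]
    rintro _ ⟨p, rfl⟩
    refine ⟨σ • TW σ p.1 p.2, Submodule.smul_mem _ _ (Submodule.subset_span ⟨p, rfl⟩), ?_⟩
    rw [map_smul, hTW, smul_smul, hσσ, one_smul]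

/-- `r̄(σ e_i ⊗ (e_j∧(e⌟Φ) − e∧(e_j⌟Φ))) = e_i ⊗ β_j` for all `i ∈ ℤ₈`, `j ∈ ℤ₇`;
consequently `r̄` (which is linear) restricts to a linear isomorphism (a bijection) from
`W̄ = span{e_i ⊗ (e_j∧(e⌟Φ) − e∧(e_j⌟Φ))}` onto `(ℝ⁸)* ⊗ span{β₀,…,β₆}`. -/
theorem stmt7 (σ : ℝ) (hσ : σ = 1 ∨ σ = -1) :
    (∀ (i : ZMod 8) (j : ZMod 7) (x y z : E8),
        rbar σ (σ • TW σ i j) x y z = ⟪u8 i, x⟫ * beta σ j ![y, z]) ∧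
    (∀ T T' : E8 → Form 8 4, rbar σ (T + T') = fun x y z => rbar σ T x y z + rbar σ T' x y z) ∧
    (∀ (c : ℝ) (T : E8 → Form 8 4), rbar σ (c • T) = fun x y z => c * rbar σ T x y z) ∧
    Set.BijOn (rbar σ)
      (Submodule.span ℝ (Set.range fun p : ZMod 8 × ZMod 7 => TW σ p.1 p.2) : Set (E8 → Form 8 4))
      (Submodule.span ℝ (Set.range fun p : ZMod 8 × ZMod 7 =>
        fun x y z : E8 => ⟪u8 p.1, x⟫ * beta σ p.2 ![y, z]) : Set (E8 → E8 → E8 → ℝ)) := by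
  exact ⟨rbar_smul_TW σ hσ, (rbarₗ σ).map_add, (rbarₗ σ).map_smul, bijOn_rbar σ hσ⟩
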